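/- Suppose (η1−ξ1, η2−ξ2) ≠ (0,0), η1 ≥ ξ1 and η2 ≥ ξ2. Then the five vectors X3(O), X4(O), [X3,X4](O), [X3,[X3,X4]](O), [X4,[X3,X4]](O) span ℝ⁴ (i.e. this family has rank 4), where O = (0,0,0,0). -/

import Mathlib

open Real Matrix Set

/-- The 4×4 matrix E(α) of the two-link magneto-elastic swimmer,
with blocks E11, E12, E21, E22 as in the paper. -/
noncomputable def Emat (l1 l2 x1 x2 e1 e2 a : ℝ) : Matrix (Fin 4) (Fin 4) ℝ :=
  !![ -(x1*l1 + x2*l2) * Real.cos a, -(x1*l1 + e2*l2) * Real.sin a,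
        (1/2)*x1*l1*l2*Real.sin a, 0;
      (e1*l1 + x2*l2) * Real.sin a, -(e1*l1 + e2*l2) * Real.cos a,
        (1/2)*e1*l1*(l1 + l2*Real.cos a), (1/2)*e1*l1^2;
      (1/2)*(e1*l1^2*(-Real.sin a)), (1/2)*(e1*l1^2*Real.cos a - e2*l2^2),
        -(e1*l1^2*((1/4)*l2*Real.cos a + (1/3)*l1) + e2*l2^2*((1/12)*l2)),
        -(e1*l1^2*((1/3)*l1));
      0, (1/2)*(-(e2*l2^2)), -(e2*l2^2*((1/12)*l2)), 0]

/-- R̃(θ) = diag(R_θ, I₂). -/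
noncomputable def Rtil (th : ℝ) : Matrix (Fin 4) (Fin 4) ℝ :=
  !![Real.cos th, -Real.sin th, 0, 0;
     Real.sin th,  Real.cos th, 0, 0;
     0, 0, 1, 0;
     0, 0, 0, 1]

/-- X3(z) = R̃(θ)·(third column of E(α)⁻¹), where z = (x,y,θ,α). -/
noncomputable def X3 (l1 l2 x1 x2 e1 e2 : ℝ) (z : Fin 4 → ℝ) : Fin 4 → ℝ :=
  (Rtil (z 2)).mulVec fun i => (Emat l1 l2 x1 x2 e1 e2 (z 3))⁻¹ i 2

/-- X4(z) = R̃(θ)·(fourth column of E(α)⁻¹), where z = (x,y,θ,α). -/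
noncomputable def X4 (l1 l2 x1 x2 e1 e2 : ℝ) (z : Fin 4 → ℝ) : Fin 4 → ℝ :=
  (Rtil (z 2)).mulVec fun i => (Emat l1 l2 x1 x2 e1 e2 (z 3))⁻¹ i 3

/-- F0(z) = κ α X4(z). -/
noncomputable def F0 (l1 l2 x1 x2 e1 e2 k : ℝ) (z : Fin 4 → ℝ) : Fin 4 → ℝ :=
  (k * z 3) • X4 l1 l2 x1 x2 e1 e2 z

/-- F1(z) = M1 sin α · X3(z). -/
noncomputable def F1 (l1 l2 x1 x2 e1 e2 M1 : ℝ) (z : Fin 4 → ℝ) : Fin 4 → ℝ :=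
  (M1 * Real.sin (z 3)) • X3 l1 l2 x1 x2 e1 e2 z

/-- F2(z) = −(M1 cos α + M2) X3(z) − M2 X4(z). -/
noncomputable def F2 (l1 l2 x1 x2 e1 e2 M1 M2 : ℝ) (z : Fin 4 → ℝ) : Fin 4 → ℝ :=
  (-(M1 * Real.cos (z 3) + M2)) • X3 l1 l2 x1 x2 e1 e2 z
    - M2 • X4 l1 l2 x1 x2 e1 e2 z

/-- Lie bracket of two vector fields on ℝ⁴: [X,Y](z) = DY(z)·X(z) − DX(z)·Y(z). -/
noncomputable def lieBr (X Y : (Fin 4 → ℝ) → (Fin 4 → ℝ)) (z : Fin 4 → ℝ) : Fin 4 → ℝ :=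
  fderiv ℝ Y z (X z) - fderiv ℝ X z (Y z)

/-- The origin O = (0,0,0,0). -/
def Ovec : Fin 4 → ℝ := ![0, 0, 0, 0]

/-- Assumption A of the paper. -/
def AssumptionA (l1 l2 x1 x2 e1 e2 M1 M2 : ℝ) : Prop :=
  ((e1 - x1, e2 - x2) ≠ (0, 0)) ∧ x1 ≤ e1 ∧ x2 ≤ e2 ∧ M1 ≠ 0 ∧ M2 ≠ 0 ∧
    (3 + 4*(l2/l1) + e2*l2^2/(e1*l1^2)) * M1
      - (3 + 4*(l1/l2) + e1*l1^2/(e2*l2^2)) * M2 ≠ 0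

/-- The infinitesimal generator of the rotations `Rtil`. -/
def rotGen : Matrix (Fin 4) (Fin 4) ℝ :=
  !![0, -1, 0, 0;
     1,  0, 0, 0;
     0,  0, 0, 0;
     0,  0, 0, 0]

/-- The rotation-equivariant vector field with profile `f`. -/
noncomputable def equivariantField (f : ℝ → Fin 4 → ℝ) (z : Fin 4 → ℝ) : Fin 4 → ℝ :=
  Rtil (z 2) *ᵥ f (z 3)

/-- The profile of the Lie bracket of two rotation-equivariant vector fields. -/
noncomputable def profileBracket (f g : ℝ → Fin 4 → ℝ) (a : ℝ) : Fin 4 → ℝ :=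
  (f a 2 • (rotGen *ᵥ g a) + f a 3 • deriv g a)
    - (g a 2 • (rotGen *ᵥ f a) + g a 3 • deriv f a)

lemma hasDerivAt_Rtil_apply (t : ℝ) (i j : Fin 4) :
    HasDerivAt (fun s => Rtil s i j) ((Rtil t * rotGen) i j) t := by
  fin_cases i <;> fin_cases j <;>
    simp [Rtil, rotGen, Matrix.mul_apply, Fin.sum_univ_four, hasDerivAt_const,
      Real.hasDerivAt_sin, Real.hasDerivAt_cos, (Real.hasDerivAt_sin t).fun_neg]

lemma fderiv_equivariantField {f : ℝ → Fin 4 → ℝ} {z : Fin 4 → ℝ}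
    (hf : DifferentiableAt ℝ f (z 3)) (d : Fin 4 → ℝ) :
    fderiv ℝ (equivariantField f) z d =
      Rtil (z 2) *ᵥ (d 2 • (rotGen *ᵥ f (z 3)) + d 3 • deriv f (z 3)) := by
  have hp (k : Fin 4) : HasFDerivAt (fun y : Fin 4 → ℝ => y k)
      (ContinuousLinearMap.proj (R := ℝ) (φ := fun _ : Fin 4 => ℝ) k) z := hasFDerivAt_apply k z
  have hR (i j : Fin 4) :
      HasFDerivAt (fun y : Fin 4 → ℝ => Rtil (y 2) i j)
        ((Rtil (z 2) * rotGen) i j • ContinuousLinearMap.proj (R := ℝ) (φ := fun _ => ℝ) 2) z :=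
    (hasDerivAt_Rtil_apply (z 2) i j).comp_hasFDerivAt (f := fun y : Fin 4 → ℝ => y 2) z (hp 2)
  have hF (j : Fin 4) : HasFDerivAt (fun y : Fin 4 → ℝ => f (y 3) j)
      (deriv f (z 3) j • ContinuousLinearMap.proj (R := ℝ) (φ := fun _ => ℝ) 3) z :=
    (hasDerivAt_pi.1 hf.hasDerivAt j).comp_hasFDerivAt (f := fun y : Fin 4 → ℝ => y 3) z (hp 3)
  have key : HasFDerivAt (equivariantField f) _ z :=
    hasFDerivAt_pi.2 fun i => HasFDerivAt.fun_sum (u := Finset.univ)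
      fun j _ => (hR i j).mul (hF j)
  rw [key.fderiv]
  ext i
  simp only [Matrix.mulVec_add, Matrix.mulVec_smul, Matrix.mulVec_mulVec]
  simp [Matrix.mulVec, dotProduct, Finset.mul_sum, ← Finset.sum_add_distrib]
  refine Finset.sum_congr rfl fun j _ => ?_
  ring

lemma equivariantField_apply_two (f : ℝ → Fin 4 → ℝ) (z : Fin 4 → ℝ) :
    equivariantField f z 2 = f (z 3) 2 := by
  simp [equivariantField, Rtil, Matrix.mulVec, dotProduct, Fin.sum_univ_four]

lemma equivariantField_apply_three (f : ℝ → Fin 4 → ℝ) (z : Fin 4 → ℝ) :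
    equivariantField f z 3 = f (z 3) 3 := by
  simp [equivariantField, Rtil, Matrix.mulVec, dotProduct, Fin.sum_univ_four]

lemma equivariantField_Ovec (f : ℝ → Fin 4 → ℝ) : equivariantField f Ovec = f 0 := by
  ext i
  fin_cases i <;>
    simp [equivariantField, Rtil, Ovec, Matrix.mulVec, dotProduct, Fin.sum_univ_four]

lemma lieBr_equivariantField {f g : ℝ → Fin 4 → ℝ} {z : Fin 4 → ℝ}
    (hf : DifferentiableAt ℝ f (z 3)) (hg : DifferentiableAt ℝ g (z 3)) :
    lieBr (equivariantField f) (equivariantField g) z =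
      equivariantField (profileBracket f g) z := by
  simp only [lieBr, fderiv_equivariantField hf, fderiv_equivariantField hg,
    equivariantField_apply_two, equivariantField_apply_three, ← Matrix.mulVec_sub]
  rfl

lemma ContDiffAt.differentiableAt_profileBracket {f g : ℝ → Fin 4 → ℝ} {a : ℝ}
    (hf : ContDiffAt ℝ 2 f a) (hg : ContDiffAt ℝ 2 g a) :
    DifferentiableAt ℝ (profileBracket f g) a := by
  have hd {h : ℝ → Fin 4 → ℝ} (hh : ContDiffAt ℝ 2 h a) : DifferentiableAt ℝ (deriv h) a :=
    (hh.derivWithin (m := 1) (by norm_num)).differentiableAt (by norm_num)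
  have hc {h : ℝ → Fin 4 → ℝ} (hh : ContDiffAt ℝ 2 h a) : DifferentiableAt ℝ h a :=
    hh.differentiableAt (by norm_num)
  have hJ {h : ℝ → Fin 4 → ℝ} (hh : ContDiffAt ℝ 2 h a) :
      DifferentiableAt ℝ (fun t => rotGen *ᵥ h t) a :=
    (LinearMap.toContinuousLinearMap (Matrix.mulVecLin rotGen)).differentiableAt.comp a (hc hh)
  have hk {h : ℝ → Fin 4 → ℝ} (hh : ContDiffAt ℝ 2 h a) (k : Fin 4) :
      DifferentiableAt ℝ (fun t => h t k) a := differentiableAt_pi.1 (hc hh) k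
  exact (((hk hf 2).smul (hJ hg)).add ((hk hf 3).smul (hd hg))).sub
    (((hk hg 2).smul (hJ hf)).add ((hk hg 3).smul (hd hf)))

/-- Smoothness of the determinant of a smooth matrix-valued function. -/
lemma contDiff_det {n : WithTop ℕ∞} {A : ℝ → Matrix (Fin 4) (Fin 4) ℝ}
    (hA : ∀ i j, ContDiff ℝ n fun t => A t i j) : ContDiff ℝ n fun t => (A t).det := by
  simp only [Matrix.det_apply]
  exact ContDiff.sum fun σ _ => (contDiff_prod fun i _ => hA _ _).const_smul _

lemma contDiffAt_inv_col {n : WithTop ℕ∞} {A : ℝ → Matrix (Fin 4) (Fin 4) ℝ}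
    (hA : ∀ i j, ContDiff ℝ n fun t => A t i j) {a : ℝ} (ha : (A a).det ≠ 0) (c : Fin 4) :
    ContDiffAt ℝ n (fun t i => (A t)⁻¹ i c) a := by
  rw [contDiffAt_pi]
  intro i
  simp only [Matrix.inv_def, Matrix.smul_apply, Ring.inverse_eq_inv', smul_eq_mul,
    Matrix.adjugate_apply]
  refine ((contDiff_det hA).contDiffAt.inv ha).mul (contDiff_det fun k l => ?_).contDiffAt
  simp only [Matrix.updateRow_apply]
  split_ifs
  · exact contDiff_const
  · exact hA k l

section Swimmer

variable {l1 l2 x1 x2 e1 e2 : ℝ}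

lemma contDiff_Emat (n : WithTop ℕ∞) (i j : Fin 4) :
    ContDiff ℝ n fun a => Emat l1 l2 x1 x2 e1 e2 a i j := by
  fin_cases i <;> fin_cases j <;> simp [Emat] <;> fun_prop

/-- The derivative of `Emat` at `α = 0`. -/
noncomputable def EmatDeriv (l1 l2 x1 x2 e1 e2 : ℝ) : Matrix (Fin 4) (Fin 4) ℝ :=
  !![0, -(x1*l1 + e2*l2), (1/2)*x1*l1*l2, 0;
     e1*l1 + x2*l2, 0, 0, 0;
     -(1/2)*(e1*l1^2), 0, 0, 0;
     0, 0, 0, 0]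

lemma hasDerivAt_Emat_zero (i j : Fin 4) :
    HasDerivAt (fun a => Emat l1 l2 x1 x2 e1 e2 a i j) (EmatDeriv l1 l2 x1 x2 e1 e2 i j) 0 := by
  refine (((contDiff_Emat 1 i j).differentiable one_ne_zero) 0).hasDerivAt.congr_deriv ?_
  fin_cases i <;> fin_cases j <;> simp [Emat, EmatDeriv]

lemma det_Emat_zero : (Emat l1 l2 x1 x2 e1 e2 0).det =
    -((x1*l1 + x2*l2) * (e1*e2*l1^3*l2^3*(e1*l1 + e2*l2) / 36)) := by
  simp [Emat, Matrix.det_succ_row_zero, Fin.sum_univ_succ, Fin.succAbove]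
  ring

lemma det_Emat_zero_ne_zero (hl1 : 0 < l1) (hl2 : 0 < l2) (hx1 : 0 < x1) (hx2 : 0 < x2)
    (he1 : 0 < e1) (he2 : 0 < e2) : (Emat l1 l2 x1 x2 e1 e2 0).det ≠ 0 := by
  rw [det_Emat_zero]
  have : 0 < (x1*l1 + x2*l2) * (e1*e2*l1^3*l2^3*(e1*l1 + e2*l2) / 36) := by positivity
  linarith

/-- The `c`-th column of `Emat⁻¹`, as a function of `α`. -/
noncomputable def EmatInvCol (l1 l2 x1 x2 e1 e2 : ℝ) (c : Fin 4) (a : ℝ) : Fin 4 → ℝ :=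
  fun i => (Emat l1 l2 x1 x2 e1 e2 a)⁻¹ i c

lemma contDiffAt_EmatInvCol (h : (Emat l1 l2 x1 x2 e1 e2 0).det ≠ 0) (n : WithTop ℕ∞)
    (c : Fin 4) : ContDiffAt ℝ n (EmatInvCol l1 l2 x1 x2 e1 e2 c) 0 :=
  contDiffAt_inv_col (contDiff_Emat n) h c

lemma eventually_Emat_mulVec_EmatInvCol (h : (Emat l1 l2 x1 x2 e1 e2 0).det ≠ 0) (c : Fin 4) :
    ∀ᶠ a in nhds 0,
      Emat l1 l2 x1 x2 e1 e2 a *ᵥ EmatInvCol l1 l2 x1 x2 e1 e2 c a = Pi.single c 1 := by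
  have hc : Continuous fun a => (Emat l1 l2 x1 x2 e1 e2 a).det :=
    (contDiff_det (contDiff_Emat 1)).continuous
  filter_upwards [hc.continuousAt.eventually_ne h] with a ha
  ext i
  have := congrFun (congrFun (Matrix.mul_nonsing_inv _ (isUnit_iff_ne_zero.2 ha)) i) c
  rw [Matrix.mul_apply] at this
  simpa [Matrix.mulVec, dotProduct, EmatInvCol, Matrix.one_apply, Pi.single_apply] using this

lemma EmatDeriv_mulVec_add {f : ℝ → Fin 4 → ℝ} {b : Fin 4 → ℝ} (hf : DifferentiableAt ℝ f 0)
    (h : ∀ᶠ a in nhds 0, Emat l1 l2 x1 x2 e1 e2 a *ᵥ f a = b) :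
    EmatDeriv l1 l2 x1 x2 e1 e2 *ᵥ f 0 + Emat l1 l2 x1 x2 e1 e2 0 *ᵥ deriv f 0 = 0 := by
  ext i
  have key : HasDerivAt (fun a => (Emat l1 l2 x1 x2 e1 e2 a *ᵥ f a) i) _ 0 :=
    HasDerivAt.fun_sum (u := Finset.univ) fun j _ =>
      (hasDerivAt_Emat_zero i j).mul (hasDerivAt_pi.1 hf.hasDerivAt j)
  have hb : (fun a => (Emat l1 l2 x1 x2 e1 e2 a *ᵥ f a) i) =ᶠ[nhds 0] fun _ => b i := by
    filter_upwards [h] with a ha using congrFun ha i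
  have := (key.congr_of_eventuallyEq hb.symm).unique (hasDerivAt_const 0 (b i))
  rw [Finset.sum_add_distrib] at this
  exact this

lemma Emat_zero_mulVec (v : Fin 4 → ℝ) :
    Emat l1 l2 x1 x2 e1 e2 0 *ᵥ v =
      ![-(x1*l1 + x2*l2) * v 0,
        -(e1*l1 + e2*l2) * v 1 + (1/2)*e1*l1*(l1 + l2) * v 2 + (1/2)*e1*l1^2 * v 3,
        (1/2)*(e1*l1^2 - e2*l2^2) * v 1 - (e1*l1^2*((1/4)*l2 + (1/3)*l1) + e2*l2^2*((1/12)*l2)) * v 2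
          - e1*l1^2*((1/3)*l1) * v 3,
        -(1/2)*(e2*l2^2) * v 1 - e2*l2^2*((1/12)*l2) * v 2] := by
  ext i
  fin_cases i <;>
    simp [Emat, Matrix.mulVec, dotProduct, Fin.sum_univ_four] <;> ring

lemma deriv_eq_smul_single {f : ℝ → Fin 4 → ℝ} {b : Fin 4 → ℝ}
    (hS : x1*l1 + x2*l2 ≠ 0) (hdet : (Emat l1 l2 x1 x2 e1 e2 0).det ≠ 0)
    (hf : DifferentiableAt ℝ f 0)
    (h : ∀ᶠ a in nhds 0, Emat l1 l2 x1 x2 e1 e2 a *ᵥ f a = b) (h0 : f 0 0 = 0) :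
    deriv f 0 = Pi.single 0
      ((-(x1*l1 + e2*l2) * f 0 1 + (1/2)*x1*l1*l2 * f 0 2) / (x1*l1 + x2*l2)) := by
  have hinj := Matrix.mulVec_injective_iff_isUnit.2
    ((Matrix.isUnit_iff_isUnit_det _).2 (isUnit_iff_ne_zero.2 hdet))
  apply hinj
  rw [← add_right_inj, EmatDeriv_mulVec_add hf h, Emat_zero_mulVec]
  ext i
  fin_cases i <;>
    simp [EmatDeriv, dotProduct, Fin.sum_univ_four, h0]
  linear_combination mul_div_cancel₀ (-(x1*l1 + e2*l2) * f 0 1 + (1/2)*x1*l1*l2 * f 0 2) hS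

/-- If the profile `w` is, at the origin, a nonzero multiple of the first basis vector, then `u`, `v`,
`w` and the brackets of `u` and `v` with `w` span. -/
lemma span_profileBracket_eq_top {u v w : ℝ → Fin 4 → ℝ} {c : ℝ} (hc : c ≠ 0)
    (hw : w 0 = Pi.single 0 c) (hP : u 0 2 * v 0 3 - u 0 3 * v 0 2 ≠ 0) :
    Submodule.span ℝ
      {u 0, v 0, w 0, profileBracket u w 0, profileBracket v w 0} = ⊤ := by
  set V := Submodule.span ℝ {u 0, v 0, w 0, profileBracket u w 0, profileBracket v w 0} with hV
  have hu : u 0 ∈ V := Submodule.subset_span (by simp)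
  have hv : v 0 ∈ V := Submodule.subset_span (by simp)
  have hA : profileBracket u w 0 ∈ V := Submodule.subset_span (by simp)
  have hB : profileBracket v w 0 ∈ V := Submodule.subset_span (by simp)
  have s0 : Pi.single 0 1 ∈ V := by
    have h : w 0 ∈ V := Submodule.subset_span (by simp)
    convert V.smul_mem c⁻¹ h using 1
    ext i
    fin_cases i <;> simp [hw, hc]
  have s1 : Pi.single 1 1 ∈ V := by
    convert V.smul_mem (c * (u 0 2 * v 0 3 - u 0 3 * v 0 2))⁻¹
      (V.sub_mem (V.smul_mem (v 0 3) hA) (V.smul_mem (u 0 3) hB)) using 1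
    rw [eq_inv_smul_iff₀ (mul_ne_zero hc hP)]
    ext i
    fin_cases i <;>
      simp [profileBracket, hw, rotGen, Fin.sum_univ_four, dotProduct] <;> ring
  have s2 : Pi.single 2 1 ∈ V := by
    convert V.smul_mem (u 0 2 * v 0 3 - u 0 3 * v 0 2)⁻¹
      (V.sub_mem (V.sub_mem (V.smul_mem (v 0 3) hu) (V.smul_mem (u 0 3) hv))
        (V.add_mem (V.smul_mem (v 0 3 * u 0 0 - u 0 3 * v 0 0) s0)
          (V.smul_mem (v 0 3 * u 0 1 - u 0 3 * v 0 1) s1))) using 1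
    rw [eq_inv_smul_iff₀ hP]
    ext i
    fin_cases i <;> simp <;> ring
  have s3 : Pi.single 3 1 ∈ V := by
    convert V.smul_mem (u 0 2 * v 0 3 - u 0 3 * v 0 2)⁻¹
      (V.sub_mem (V.sub_mem (V.smul_mem (u 0 2) hv) (V.smul_mem (v 0 2) hu))
        (V.add_mem (V.smul_mem (u 0 2 * v 0 0 - v 0 2 * u 0 0) s0)
          (V.smul_mem (u 0 2 * v 0 1 - v 0 2 * u 0 1) s1))) using 1
    rw [eq_inv_smul_iff₀ hP]
    ext i
    fin_cases i <;> simp <;> ring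
  rw [eq_top_iff, ← (Pi.basisFun ℝ (Fin 4)).span_eq, Submodule.span_le]
  rintro _ ⟨i, rfl⟩
  fin_cases i <;> simpa

/-- The minor of the last two coordinates of the solutions of `E(0) u = e₃`, `E(0) v = e₄`
is nonzero. -/
lemma minor_ne_zero {u v : Fin 4 → ℝ} (hT : e1*l1 + e2*l2 ≠ 0)
    (hu : Emat l1 l2 x1 x2 e1 e2 0 *ᵥ u = Pi.single 2 1)
    (hv : Emat l1 l2 x1 x2 e1 e2 0 *ᵥ v = Pi.single 3 1) :
    u 2 * v 3 - u 3 * v 2 ≠ 0 := by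
  intro hP
  rw [Emat_zero_mulVec] at hu hv
  have u1 := congrFun hu 1
  have u2 := congrFun hu 2
  have u3 := congrFun hu 3
  have v1 := congrFun hv 1
  have v2 := congrFun hv 2
  have v3 := congrFun hv 3
  simp at u1 u2 u3 v1 v2 v3
  have h12 : u 1 * v 2 - u 2 * v 1 = 0 := by
    refine (mul_eq_zero.1 ?_).resolve_left hT
    linear_combination u 2 * v1 - v 2 * u1 - (1/2)*e1*l1^2 * hP
  have h13 : u 1 * v 3 - u 3 * v 1 = 0 := by
    refine (mul_eq_zero.1 ?_).resolve_left hT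
    linear_combination u 3 * v1 - v 3 * u1 + (1/2)*e1*l1*(l1 + l2) * hP
  have h : (1 : ℝ) = 0 := by
    linear_combination
      ((1/2)*(e1*l1^2 - e2*l2^2) * -(e2*l2^2*((1/12)*l2))
        - (e1*l1^2*((1/4)*l2 + (1/3)*l1) + e2*l2^2*((1/12)*l2)) * ((1/2)*(e2*l2^2))) * h12
      - e1*l1^2*((1/3)*l1) * ((1/2)*(e2*l2^2)) * h13
      - e1*l1^2*((1/3)*l1) * (e2*l2^2*((1/12)*l2)) * hP
      - (-(1/2)*(e2*l2^2) * v 1 - e2*l2^2*((1/12)*l2) * v 2) * u2 - v3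
      + (-(1/2)*(e2*l2^2) * u 1 - e2*l2^2*((1/12)*l2) * u 2) * v2
  exact one_ne_zero h

/-- The first coordinate of `[X3, X4]` at the origin, up to a nonzero factor. -/
lemma bracket_coordinate_formula {u v : Fin 4 → ℝ} (hS : x1*l1 + x2*l2 ≠ 0)
    (hu : Emat l1 l2 x1 x2 e1 e2 0 *ᵥ u = Pi.single 2 1)
    (hv : Emat l1 l2 x1 x2 e1 e2 0 *ᵥ v = Pi.single 3 1) :
    (e1*l1 + e2*l2) * (x1*l1 + x2*l2) *
      (u 1 * v 2 - u 2 * v 1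
        + u 3 * ((-(x1*l1 + e2*l2) * v 1 + (1/2)*x1*l1*l2 * v 2) / (x1*l1 + x2*l2))
        - v 3 * ((-(x1*l1 + e2*l2) * u 1 + (1/2)*x1*l1*l2 * u 2) / (x1*l1 + x2*l2))) =
      (1/2) * l1 * l2 * (e1*l1*(e2 - x2) + e2*l2*(e1 - x1)) * (u 2 * v 3 - u 3 * v 2) := by
  rw [Emat_zero_mulVec] at hu hv
  have u1 := congrFun hu 1
  have v1 := congrFun hv 1
  simp at u1 v1
  have hp := mul_div_cancel₀ (-(x1*l1 + e2*l2) * u 1 + (1/2)*x1*l1*l2 * u 2) hS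
  have hq := mul_div_cancel₀ (-(x1*l1 + e2*l2) * v 1 + (1/2)*x1*l1*l2 * v 2) hS
  linear_combination (e1*l1 + e2*l2) * (u 3 * hq - v 3 * hp)
    + (x1*l1 + x2*l2) * (u 2 * v1 - v 2 * u1) + (x1*l1 + e2*l2) * (u 3 * v1 - v 3 * u1)

lemma profileBracket_zero_eq_single {u v : ℝ → Fin 4 → ℝ} {p q : ℝ} (hu0 : u 0 0 = 0)
    (hv0 : v 0 0 = 0) (hu : deriv u 0 = Pi.single 0 p) (hv : deriv v 0 = Pi.single 0 q) :
    profileBracket u v 0 =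
      Pi.single 0 (u 0 1 * v 0 2 - u 0 2 * v 0 1 + u 0 3 * q - v 0 3 * p) := by
  ext i
  fin_cases i <;>
    simp [profileBracket, hu, hv, hu0, hv0, rotGen, dotProduct, Fin.sum_univ_four, vecHead,
      vecTail]
  ring

lemma apply_zero_eq_zero_of_Emat_mulVec (hS : x1*l1 + x2*l2 ≠ 0) {u b : Fin 4 → ℝ} (hb : b 0 = 0)
    (h : Emat l1 l2 x1 x2 e1 e2 0 *ᵥ u = b) : u 0 = 0 := by
  rw [Emat_zero_mulVec] at h
  have := congrFun h 0
  rw [hb] at this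
  exact (mul_eq_zero.1 this).resolve_left (neg_ne_zero.2 hS)

end Swimmer

/-- the X-brackets span ℝ⁴ at the origin. -/
theorem stmt_9 (l1 l2 x1 x2 e1 e2 k M1 M2 : ℝ)
    (hl1 : 0 < l1) (hl2 : 0 < l2) (hx1 : 0 < x1) (hx2 : 0 < x2)
    (he1 : 0 < e1) (he2 : 0 < e2) (hk : 0 < k)
    (hne : (e1 - x1, e2 - x2) ≠ ((0:ℝ), (0:ℝ))) (h1 : x1 ≤ e1) (h2 : x2 ≤ e2) :
    Submodule.span ℝ
      ({X3 l1 l2 x1 x2 e1 e2 Ovec,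
        X4 l1 l2 x1 x2 e1 e2 Ovec,
        lieBr (X3 l1 l2 x1 x2 e1 e2) (X4 l1 l2 x1 x2 e1 e2) Ovec,
        lieBr (X3 l1 l2 x1 x2 e1 e2)
          (lieBr (X3 l1 l2 x1 x2 e1 e2) (X4 l1 l2 x1 x2 e1 e2)) Ovec,
        lieBr (X4 l1 l2 x1 x2 e1 e2)
          (lieBr (X3 l1 l2 x1 x2 e1 e2) (X4 l1 l2 x1 x2 e1 e2)) Ovec} :
        Set (Fin 4 → ℝ)) = ⊤ := by
  have hS : x1*l1 + x2*l2 ≠ 0 := by positivity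
  have hT : e1*l1 + e2*l2 ≠ 0 := by positivity
  have hdet := det_Emat_zero_ne_zero hl1 hl2 hx1 hx2 he1 he2
  set u := EmatInvCol l1 l2 x1 x2 e1 e2 2
  set v := EmatInvCol l1 l2 x1 x2 e1 e2 3
  have hX3 : X3 l1 l2 x1 x2 e1 e2 = equivariantField u := rfl
  have hX4 : X4 l1 l2 x1 x2 e1 e2 = equivariantField v := rfl
  have cu : ContDiffAt ℝ 2 u 0 := contDiffAt_EmatInvCol hdet 2 2
  have cv : ContDiffAt ℝ 2 v 0 := contDiffAt_EmatInvCol hdet 2 3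
  have du : DifferentiableAt ℝ u 0 := cu.differentiableAt two_ne_zero
  have dv : DifferentiableAt ℝ v 0 := cv.differentiableAt two_ne_zero
  have dw : DifferentiableAt ℝ (profileBracket u v) 0 := cu.differentiableAt_profileBracket cv
  have eu := eventually_Emat_mulVec_EmatInvCol hdet 2
  have ev := eventually_Emat_mulVec_EmatInvCol hdet 3
  have u0 : u 0 0 = 0 := apply_zero_eq_zero_of_Emat_mulVec hS (by simp) eu.self_of_nhds
  have v0 : v 0 0 = 0 := apply_zero_eq_zero_of_Emat_mulVec hS (by simp) ev.self_of_nhds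
  have hw := profileBracket_zero_eq_single u0 v0 (deriv_eq_smul_single hS hdet du eu u0)
    (deriv_eq_smul_single hS hdet dv ev v0)
  have hP := minor_ne_zero hT eu.self_of_nhds ev.self_of_nhds
  have hK : e1*l1*(e2 - x2) + e2*l2*(e1 - x1) ≠ 0 := by
    intro h
    have a1 : 0 ≤ e1*l1*(e2 - x2) := mul_nonneg (by positivity) (by linarith)
    have a2 : 0 ≤ e2*l2*(e1 - x1) := mul_nonneg (by positivity) (by linarith)
    have b1 : e2 - x2 = 0 := (mul_eq_zero.1 (by linarith)).resolve_left (mul_pos he1 hl1).ne'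
    have b2 : e1 - x1 = 0 := (mul_eq_zero.1 (by linarith)).resolve_left (mul_pos he2 hl2).ne'
    exact hne (by rw [b1, b2])
  have hc := bracket_coordinate_formula hS eu.self_of_nhds ev.self_of_nhds
  have hspan := span_profileBracket_eq_top
    (right_ne_zero_of_mul (hc.trans_ne (by positivity))) hw hP
  have hev : lieBr (equivariantField u) (equivariantField v) =ᶠ[nhds Ovec]
      equivariantField (profileBracket u v) := by
    have ht : Filter.Tendsto (fun z : Fin 4 → ℝ => z 3) (nhds Ovec) (nhds 0) :=
      (continuous_apply 3).tendsto Ovec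
    filter_upwards [ht.eventually (cu.eventually (by simp)),
      ht.eventually (cv.eventually (by simp))] with z zu zv
    exact lieBr_equivariantField (zu.differentiableAt two_ne_zero)
      (zv.differentiableAt two_ne_zero)
  have hout {f : ℝ → Fin 4 → ℝ} (df : DifferentiableAt ℝ f 0) :
      lieBr (equivariantField f) (lieBr (equivariantField u) (equivariantField v)) Ovec =
        profileBracket f (profileBracket u v) 0 := by
    rw [lieBr, hev.fderiv_eq, hev.eq_of_nhds]
    exact (lieBr_equivariantField (z := Ovec) df dw).trans (equivariantField_Ovec _)
  rw [hX3, hX4, hout du, hout dv, hev.eq_of_nhds]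
  simpa only [equivariantField_Ovec] using hspan
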